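/- For every point x in X = supp(μ), one has d̲(μ,x) < d̄(μ,x); in particular the local dimension lim_{r→0+} log μ(B(x,r))/log r exists at no point of the support of μ. -/

import Mathlib

open MeasureTheory Filter Set Metric Topology

/-- `moranCyl c w n (x, ℓ)` refines the interval `[x, x + ℓ]` along the binary word `w`,
using the contraction ratio `c k` at step `k` (the first letter of `w` is processed with
index `n`).  The result `(x', ℓ')` describes the interval `[x', x' + ℓ']`. -/
noncomputable def moranCyl (c : ℕ → ℝ) : List Bool → ℕ → ℝ × ℝ → ℝ × ℝ
  | [], _, st => st
  | bb :: w, n, st =>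
      moranCyl c w (n + 1)
        (if bb then (st.1 + st.2 - st.2 / c n, st.2 / c n) else (st.1, st.2 / c n))

/-- The basic interval `I_w` of the Moran construction with ratios `c`. -/
noncomputable def moranI (c : ℕ → ℝ) (w : List Bool) : Set ℝ :=
  Icc (moranCyl c w 1 (0, 1)).1 ((moranCyl c w 1 (0, 1)).1 + (moranCyl c w 1 (0, 1)).2)

/-- The length `|I_w|` of the basic interval `I_w`. -/
noncomputable def moranLen (c : ℕ → ℝ) (w : List Bool) : ℝ :=
  (moranCyl c w 1 (0, 1)).2

/-- The Moran set `⋂ n ⋃ {I_w : |w| = n}`. -/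
noncomputable def moranSet (c : ℕ → ℝ) : Set ℝ :=
  ⋂ n : ℕ, ⋃ w ∈ {w : List Bool | w.length = n}, moranI c w

/-- The mass assigned to the cylinder `I_w` by the Moran measure with weight `r k` for the
letter at step `k`: `cylMass r w 1 1 = μ(I_w)`. -/
noncomputable def cylMass (r : ℕ → ℝ) : List Bool → ℕ → ℝ → ℝ
  | [], _, m => m
  | bb :: w, n, m => cylMass r w (n + 1) (if bb then (1 - r n) * m else r n * m)

/-- Lower local dimension `liminf_{r → 0⁺} log μ(B(x,r)) / log r`. -/
noncomputable def lowerLocalDim (μ : Measure ℝ) (x : ℝ) : ℝ :=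
  liminf (fun rr : ℝ => Real.log (μ (closedBall x rr)).toReal / Real.log rr) (𝓝[>] 0)

/-- Upper local dimension `limsup_{r → 0⁺} log μ(B(x,r)) / log r`. -/
noncomputable def upperLocalDim (μ : Measure ℝ) (x : ℝ) : ℝ :=
  limsup (fun rr : ℝ => Real.log (μ (closedBall x rr)).toReal / Real.log rr) (𝓝[>] 0)

/-- `betaFn ρ C s = -log (ρ^s + (1-ρ)^s) / log C`; so `β₁ = betaFn p A`, `β₂ = betaFn q B`. -/
noncomputable def betaFn (ρ C : ℝ) (s : ℝ) : ℝ :=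
  -Real.log (ρ ^ s + (1 - ρ) ^ s) / Real.log C

/-- The Legendre transform `f^*(α) = inf_s (s α - f(s))`. -/
noncomputable def legendre (f : ℝ → ℝ) (α : ℝ) : ℝ :=
  ⨅ s : ℝ, (s * α - f s)

/-- The modification `β̃₁` of `β₁`, linear on `(0,1)`. -/
noncomputable def betaTilde1 (ρ C : ℝ) (s : ℝ) : ℝ :=
  if s ≤ 0 ∨ 1 ≤ s then betaFn ρ C s
  else (1 - s) * betaFn ρ C 0 + s * betaFn ρ C 1

/-- `packSup μ X r s` is the supremum of `∑ᵢ μ(B(xᵢ,r))^s` over all finite families of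
pairwise disjoint closed balls of radius `r` with centers in `X`. -/
noncomputable def packSup (μ : Measure ℝ) (X : Set ℝ) (rr s : ℝ) : ℝ :=
  sSup {y : ℝ | ∃ t : Finset ℝ, (↑t : Set ℝ) ⊆ X ∧
    (↑t : Set ℝ).Pairwise (fun u v => Disjoint (closedBall u rr) (closedBall v rr)) ∧
    y = ∑ u ∈ t, (μ (closedBall u rr)).toReal ^ s}

lemma moranCyl_append_singleton (c : ℕ → ℝ) (b : Bool) (w : List Bool) (n : ℕ) (st : ℝ × ℝ) :
    moranCyl c (w ++ [b]) n st =
      if b then ((moranCyl c w n st).1 + (moranCyl c w n st).2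
          - (moranCyl c w n st).2 / c (n + w.length), (moranCyl c w n st).2 / c (n + w.length))
      else ((moranCyl c w n st).1, (moranCyl c w n st).2 / c (n + w.length)) := by
  induction w generalizing n st with
  | nil => simp [moranCyl]
  | cons a w ih =>
    have h : n + 1 + w.length = n + (a :: w).length := by simp; omega
    simp only [List.cons_append, moranCyl, ih, h]

lemma cylMass_append_singleton (r : ℕ → ℝ) (b : Bool) (w : List Bool) (n : ℕ) (m : ℝ) :
    cylMass r (w ++ [b]) n m =
      if b then (1 - r (n + w.length)) * cylMass r w n m
      else r (n + w.length) * cylMass r w n m := by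
  induction w generalizing n m with
  | nil => simp [cylMass]
  | cons a w ih =>
    have h : n + 1 + w.length = n + (a :: w).length := by simp; omega
    simp only [List.cons_append, cylMass, ih, h]

lemma moranLen_append_singleton (c : ℕ → ℝ) (b : Bool) (w : List Bool) :
    moranLen c (w ++ [b]) = moranLen c w / c (w.length + 1) := by
  unfold moranLen
  rw [moranCyl_append_singleton, add_comm 1]
  split_ifs <;> rfl

/-- The basic intervals of level `n` all have length `exp (-∑_{k ≤ n} log c_k)`. -/
lemma moranLen_eq_exp {c : ℕ → ℝ} (hc : ∀ k, 0 < c (k + 1)) (w : List Bool) :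
    moranLen c w = Real.exp (-∑ k ∈ Finset.range w.length, Real.log (c (k + 1))) := by
  induction w using List.reverseRecOn with
  | nil => simp [moranLen, moranCyl]
  | append_singleton w b ih =>
    rw [moranLen_append_singleton, ih, List.length_append, List.length_singleton,
      Finset.sum_range_succ, neg_add, Real.exp_add, Real.exp_neg (Real.log _),
      Real.exp_log (hc _), div_eq_mul_inv]

lemma exp_le_cylMass {r : ℕ → ℝ} (hr0 : ∀ k, 0 < r (k + 1)) (hr2 : ∀ k, r (k + 1) ≤ 1 / 2)
    (w : List Bool) :
    Real.exp (-∑ k ∈ Finset.range w.length, -Real.log (r (k + 1))) ≤ cylMass r w 1 1 := by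
  induction w using List.reverseRecOn with
  | nil => simp [cylMass]
  | append_singleton w b ih =>
    have h0 := hr0 w.length
    have h2 := hr2 w.length
    rw [cylMass_append_singleton, List.length_append, List.length_singleton,
      Finset.sum_range_succ, neg_add, Real.exp_add, neg_neg, Real.exp_log h0, mul_comm, add_comm 1]
    have hle := mul_le_mul_of_nonneg_left ih h0.le
    split_ifs
    · refine hle.trans (mul_le_mul_of_nonneg_right (by linarith) ((Real.exp_pos _).le.trans ih))
    · exact hle

lemma cylMass_le_exp {r : ℕ → ℝ} (hr0 : ∀ k, 0 < r (k + 1)) (hr2 : ∀ k, r (k + 1) ≤ 1 / 2)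
    (w : List Bool) :
    cylMass r w 1 1 ≤ Real.exp (-∑ k ∈ Finset.range w.length, -Real.log (1 - r (k + 1))) := by
  induction w using List.reverseRecOn with
  | nil => simp [cylMass]
  | append_singleton w b ih =>
    have h0 := hr0 w.length
    have h2 := hr2 w.length
    have h1 : 0 < 1 - r (w.length + 1) := by linarith
    have hpos := (Real.exp_pos _).le.trans (exp_le_cylMass hr0 hr2 w)
    rw [cylMass_append_singleton, List.length_append, List.length_singleton,
      Finset.sum_range_succ, neg_add, Real.exp_add, neg_neg, Real.exp_log h1,
      mul_comm (Real.exp _), add_comm 1]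
    have hle := mul_le_mul_of_nonneg_left ih h1.le
    split_ifs
    · exact hle
    · exact (mul_le_mul_of_nonneg_right (by linarith) hpos).trans hle

lemma moranI_subset_closedBall {c : ℕ → ℝ} {w : List Bool} {x : ℝ} (hx : x ∈ moranI c w) :
    moranI c w ⊆ closedBall x (moranLen c w) := by
  intro y hy
  simp only [moranI, mem_Icc] at hx hy
  rw [mem_closedBall, Real.dist_eq, abs_le, moranLen]
  constructor <;> linarith

lemma moranI_append_true (c : ℕ → ℝ) (w : List Bool) :
    moranI c (w ++ [true]) =
      Icc ((moranCyl c w 1 (0, 1)).1 + moranLen c w - moranLen c w / c (w.length + 1))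
        ((moranCyl c w 1 (0, 1)).1 + moranLen c w) := by
  unfold moranI moranLen
  rw [moranCyl_append_singleton, add_comm 1]
  simp

lemma moranI_append_false (c : ℕ → ℝ) (w : List Bool) :
    moranI c (w ++ [false]) =
      Icc (moranCyl c w 1 (0, 1)).1
        ((moranCyl c w 1 (0, 1)).1 + moranLen c w / c (w.length + 1)) := by
  unfold moranI moranLen
  rw [moranCyl_append_singleton, add_comm 1]
  simp

lemma measurableSet_moranI (c : ℕ → ℝ) (w : List Bool) : MeasurableSet (moranI c w) := by
  unfold moranI
  exact measurableSet_Icc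

/-- A small ball centred in a basic interval `I_w` carries no mass outside of `I_w`. -/
lemma measure_closedBall_diff_moranI {B : ℝ} {c r : ℕ → ℝ} (hB2 : 2 < B)
    (hc : ∀ k, B ≤ c (k + 1)) (hr0 : ∀ k, 0 < r (k + 1)) (hr2 : ∀ k, r (k + 1) ≤ 1 / 2)
    (μ : Measure ℝ) [IsProbabilityMeasure μ]
    (hμ : ∀ w : List Bool, μ (moranI c w) = ENNReal.ofReal (cylMass r w 1 1))
    {x ρ : ℝ} (w : List Bool) (hx : x ∈ moranI c w) (hρ : ρ < (B - 2) * moranLen c w) :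
    μ (closedBall x ρ \ moranI c w) = 0 := by
  induction w using List.reverseRecOn with
  | nil =>
    have h1 : μ (moranI c [])ᶜ = 0 := by
      rw [prob_compl_eq_zero_iff (measurableSet_moranI c []), hμ]
      simp [cylMass]
    exact measure_mono_null (fun y hy => hy.2) h1
  | append_singleton w b ih =>
    have hcpos : ∀ k, 0 < c (k + 1) := fun k => by linarith [hc k]
    have hlen : 0 < moranLen c w := by rw [moranLen_eq_exp hcpos]; exact Real.exp_pos _
    have hCB : B ≤ c (w.length + 1) := hc w.length
    have hC0 : 0 < c (w.length + 1) := by linarith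
    rw [moranLen_append_singleton] at hρ
    have hI : moranI c w = Icc (moranCyl c w 1 (0, 1)).1
        ((moranCyl c w 1 (0, 1)).1 + moranLen c w) := rfl
    have hI0 := moranI_append_false c w
    have hI1 := moranI_append_true c w
    have hL : 0 < moranLen c w / c (w.length + 1) := div_pos hlen hC0
    have hgap : (B - 2) * (moranLen c w / c (w.length + 1)) ≤
        moranLen c w - 2 * (moranLen c w / c (w.length + 1)) := by
      have h1 : moranLen c w = c (w.length + 1) * (moranLen c w / c (w.length + 1)) := by
        field_simp
      nlinarith
    set a := (moranCyl c w 1 (0, 1)).1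
    set L := moranLen c w / c (w.length + 1)
    set ℓ := moranLen c w
    have hLpos : 0 < (B - 2) * L := mul_pos (by linarith) hL
    have hxw : x ∈ moranI c w := by
      cases b
      · rw [hI0] at hx
        exact hI ▸ ⟨hx.1, by linarith [hx.2]⟩
      · rw [hI1] at hx
        exact hI ▸ ⟨by linarith [hx.1], hx.2⟩
    have hball := ih hxw (by nlinarith)
    have hdisj : Disjoint (moranI c (w ++ [false])) (moranI c (w ++ [true])) := by
      rw [hI0, hI1, Set.disjoint_left]
      intro y hy hy'
      linarith [hy.2, hy'.1]
    have hsub : moranI c (w ++ [false]) ∪ moranI c (w ++ [true]) ⊆ moranI c w := by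
      rw [hI, hI0, hI1]
      exact union_subset (Icc_subset_Icc le_rfl (by linarith))
        (Icc_subset_Icc (by linarith) le_rfl)
    have hrest : μ (moranI c w \ (moranI c (w ++ [false]) ∪ moranI c (w ++ [true]))) = 0 := by
      have hnn : ∀ v, 0 ≤ cylMass r v 1 1 := fun v =>
        (Real.exp_pos _).le.trans (exp_le_cylMass hr0 hr2 v)
      rw [measure_sdiff hsub ((measurableSet_moranI c _).union
        (measurableSet_moranI c _)).nullMeasurableSet (measure_ne_top μ _),
        measure_union hdisj (measurableSet_moranI c _), hμ, hμ, hμ,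
        ← ENNReal.ofReal_add (hnn _) (hnn _), cylMass_append_singleton, cylMass_append_singleton,
        if_neg Bool.false_ne_true, if_pos rfl, ← add_mul, add_sub_cancel, one_mul, tsub_self]
    refine measure_mono_null ?_ (measure_union_null hball hrest)
    rintro y ⟨hyball, hy⟩
    rw [mem_closedBall, Real.dist_eq, abs_le] at hyball
    by_cases hyw : y ∈ moranI c w
    · refine Or.inr ⟨hyw, ?_⟩
      rintro (h | h)
      · cases b
        · exact hy h
        · rw [hI0] at h
          rw [hI1] at hx
          linarith [h.2, hx.1, hyball.1]
      · cases b
        · rw [hI1] at h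
          rw [hI0] at hx
          linarith [h.1, hx.2, hyball.2]
        · exact hy h
    · exact Or.inl ⟨by rwa [mem_closedBall, Real.dist_eq, abs_le], hyw⟩

lemma exists_mem_moranI {c : ℕ → ℝ} {x : ℝ} (hx : x ∈ moranSet c) (n : ℕ) :
    ∃ w : List Bool, w.length = n ∧ x ∈ moranI c w := by
  simpa [moranSet] using mem_iInter.1 hx n

lemma exp_le_measure_closedBall {c r : ℕ → ℝ} (hc : ∀ k, 0 < c (k + 1))
    (hr0 : ∀ k, 0 < r (k + 1)) (hr2 : ∀ k, r (k + 1) ≤ 1 / 2)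
    (μ : Measure ℝ) [IsProbabilityMeasure μ]
    (hμ : ∀ w : List Bool, μ (moranI c w) = ENNReal.ofReal (cylMass r w 1 1))
    {x ρ : ℝ} (hx : x ∈ moranSet c) (n : ℕ)
    (hρ : Real.exp (-∑ k ∈ Finset.range n, Real.log (c (k + 1))) ≤ ρ) :
    Real.exp (-∑ k ∈ Finset.range n, -Real.log (r (k + 1))) ≤ (μ (closedBall x ρ)).toReal := by
  obtain ⟨w, rfl, hw⟩ := exists_mem_moranI hx n
  rw [← moranLen_eq_exp hc] at hρ
  refine (exp_le_cylMass hr0 hr2 w).trans ?_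
  rw [← ENNReal.ofReal_le_iff_le_toReal (measure_ne_top μ _), ← hμ]
  exact measure_mono ((moranI_subset_closedBall hw).trans (closedBall_subset_closedBall hρ))

lemma measure_closedBall_le_exp {B : ℝ} {c r : ℕ → ℝ} (hB2 : 2 < B)
    (hc : ∀ k, B ≤ c (k + 1)) (hr0 : ∀ k, 0 < r (k + 1)) (hr2 : ∀ k, r (k + 1) ≤ 1 / 2)
    (μ : Measure ℝ) [IsProbabilityMeasure μ]
    (hμ : ∀ w : List Bool, μ (moranI c w) = ENNReal.ofReal (cylMass r w 1 1))
    {x ρ : ℝ} (hx : x ∈ moranSet c) (n : ℕ)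
    (hρ : ρ < (B - 2) * Real.exp (-∑ k ∈ Finset.range n, Real.log (c (k + 1)))) :
    (μ (closedBall x ρ)).toReal ≤ Real.exp (-∑ k ∈ Finset.range n, -Real.log (1 - r (k + 1))) := by
  obtain ⟨w, rfl, hw⟩ := exists_mem_moranI hx n
  rw [← moranLen_eq_exp (fun k => by linarith [hc k])] at hρ
  refine le_trans ?_ (cylMass_le_exp hr0 hr2 w)
  refine ENNReal.toReal_le_of_le_ofReal ((Real.exp_pos _).le.trans (exp_le_cylMass hr0 hr2 w)) ?_
  rw [← hμ, ← add_zero (μ (moranI c w)),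
    ← measure_closedBall_diff_moranI hB2 hc hr0 hr2 μ hμ w hw hρ, add_comm]
  exact (measure_le_inter_add_sdiff μ _ (moranI c w)).trans
    (by rw [add_comm]; exact add_le_add_right (measure_mono inter_subset_right) _)

/-- Cesàro averages of a bounded sequence `u`, taken at times `n i` such that `u` is equal to `v`
on a block `(m i, n i]` with `m i / n i → 0`, converge to `v`. -/
lemma tendsto_average_of_eq_on_block {u : ℕ → ℝ} {v K : ℝ} (hu : ∀ k, |u (k + 1)| ≤ K)
    {m n : ℕ → ℕ} (hmn : ∀ i, m i < n i)
    (hlim : Tendsto (fun i => (m i : ℝ) / n i) atTop (𝓝 0))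
    (hv : ∀ i k, m i < k → k ≤ n i → u k = v) :
    Tendsto (fun i => (∑ k ∈ Finset.range (n i), u (k + 1)) / n i) atTop (𝓝 v) := by
  rw [tendsto_iff_norm_sub_tendsto_zero]
  refine squeeze_zero (fun _ => norm_nonneg _) (fun i => ?_)
    (by simpa using hlim.const_mul (K + |v|))
  have hn : (0 : ℝ) < n i := by exact_mod_cast (Nat.zero_le _).trans_lt (hmn i)
  have h1 : (∑ k ∈ Finset.range (n i), u (k + 1)) / n i - v =
      (∑ k ∈ Finset.range (m i), (u (k + 1) - v)) / n i := by
    have h2 : ∑ k ∈ Finset.range (n i), (u (k + 1) - v) =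
        ∑ k ∈ Finset.range (m i), (u (k + 1) - v) := by
      symm
      refine Finset.sum_subset (Finset.range_mono (hmn i).le) fun k hk hk' => ?_
      rw [Finset.mem_range] at hk hk'
      rw [hv i (k + 1) (by omega) (by omega), sub_self]
    rw [← h2, Finset.sum_sub_distrib, Finset.sum_const, Finset.card_range, nsmul_eq_mul]
    field_simp
  rw [h1, Real.norm_eq_abs, abs_div, abs_of_pos hn, mul_div_assoc']
  refine div_le_div_of_nonneg_right ((Finset.abs_sum_le_sum_abs _ _).trans ?_) hn.le
  refine (Finset.sum_le_card_nsmul _ _ (K + |v|) fun k _ => ?_).trans_eq ?_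
  · exact (abs_sub _ _).trans (by linarith [hu k])
  · rw [Finset.card_range, nsmul_eq_mul, mul_comm]

lemma tendsto_div_add_const {S L n : ℕ → ℝ} {a b : ℝ} (D : ℝ) (hb : b ≠ 0)
    (hn : Tendsto n atTop atTop) (hS : Tendsto (fun i => S i / n i) atTop (𝓝 a))
    (hL : Tendsto (fun i => L i / n i) atTop (𝓝 b)) :
    Tendsto (fun i => S i / (L i + D)) atTop (𝓝 (a / b)) := by
  have hD : Tendsto (fun i => L i / n i + D / n i) atTop (𝓝 b) := by
    simpa using hL.add (hn.const_div_atTop D)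
  refine (hS.div hD hb).congr' ?_
  filter_upwards [hn.eventually_gt_atTop 0] with i hi
  rw [Pi.div_apply, ← add_div, div_div_div_cancel_right₀ hi.ne']

lemma tendsto_exp_neg_add_const {L n : ℕ → ℝ} {b : ℝ} (D : ℝ) (hb : 0 < b)
    (hn : Tendsto n atTop atTop) (hL : Tendsto (fun i => L i / n i) atTop (𝓝 b)) :
    Tendsto (fun i => L i + D) atTop atTop ∧
      Tendsto (fun i => Real.exp (-(L i + D))) atTop (𝓝[>] 0) := by
  have h : Tendsto (fun i => L i + D) atTop atTop := by
    refine tendsto_atTop_add_const_right _ _ ((hL.pos_mul_atTop hb hn).congr' ?_)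
    filter_upwards [hn.eventually_gt_atTop 0] with i hi
    exact div_mul_cancel₀ _ hi.ne'
  exact ⟨h, tendsto_nhdsWithin_iff.2
    ⟨Real.tendsto_exp_neg_atTop_nhds_zero.comp h, Eventually.of_forall fun _ => Real.exp_pos _⟩⟩

lemma eventually_log_measure_div_log_nonneg (μ : Measure ℝ) [IsProbabilityMeasure μ] (x : ℝ) :
    ∀ᶠ ρ in 𝓝[>] (0 : ℝ), 0 ≤ Real.log (μ (closedBall x ρ)).toReal / Real.log ρ := by
  filter_upwards [Ioo_mem_nhdsGT one_pos] with ρ hρ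
  refine div_nonneg_of_nonpos ?_ (Real.log_nonpos hρ.1.le hρ.2.le)
  exact Real.log_nonpos ENNReal.toReal_nonneg (ENNReal.toReal_mono ENNReal.one_ne_top prob_le_one)

lemma exists_exp_sum_log_le {B : ℝ} {c : ℕ → ℝ} (hB : 1 < B) (hc : ∀ k, B ≤ c (k + 1)) {ρ : ℝ}
    (hρ : 0 < ρ) (hρ1 : ρ ≤ 1) :
    ∃ n : ℕ, (n : ℝ) < -Real.log ρ / Real.log B + 1 ∧
      Real.exp (-∑ k ∈ Finset.range n, Real.log (c (k + 1))) ≤ ρ := by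
  have hlB : 0 < Real.log B := Real.log_pos hB
  have hlρ : Real.log ρ ≤ 0 := Real.log_nonpos hρ.le hρ1
  refine ⟨⌈-Real.log ρ / Real.log B⌉₊,
    Nat.ceil_lt_add_one (div_nonneg (by linarith) hlB.le), ?_⟩
  have h1 := Nat.le_ceil (-Real.log ρ / Real.log B)
  set n := ⌈-Real.log ρ / Real.log B⌉₊
  rw [div_le_iff₀ hlB] at h1
  rw [← Real.le_log_iff_exp_le hρ]
  have h2 := Finset.card_nsmul_le_sum (Finset.range n) (fun k => Real.log (c (k + 1)))
    (Real.log B) fun k _ => Real.log_le_log (by linarith) (hc k)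
  rw [Finset.card_range, nsmul_eq_mul] at h2
  linarith

lemma eventually_log_measure_div_log_le {B K : ℝ} {c r : ℕ → ℝ} (hB : 1 < B)
    (hc : ∀ k, B ≤ c (k + 1)) (hr0 : ∀ k, 0 < r (k + 1)) (hr2 : ∀ k, r (k + 1) ≤ 1 / 2)
    (hK : ∀ k, -Real.log (r (k + 1)) ≤ K)
    (μ : Measure ℝ) [IsProbabilityMeasure μ]
    (hμ : ∀ w : List Bool, μ (moranI c w) = ENNReal.ofReal (cylMass r w 1 1))
    {x : ℝ} (hx : x ∈ moranSet c) :
    ∀ᶠ ρ in 𝓝[>] (0 : ℝ), Real.log (μ (closedBall x ρ)).toReal / Real.log ρ ≤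
      (1 / Real.log B + 1) * K := by
  have hlB : 0 < Real.log B := Real.log_pos hB
  have hK0 : 0 ≤ K := by
    have := Real.log_nonpos (hr0 0).le (by linarith [hr2 0])
    linarith [hK 0]
  filter_upwards [Ioo_mem_nhdsGT (Real.exp_pos (-1))] with ρ hρ
  have ht : Real.log ρ < -1 := (Real.log_lt_iff_lt_exp hρ.1).2 hρ.2
  have hρ1 : ρ ≤ 1 := hρ.2.le.trans (Real.exp_le_one_iff.2 (by norm_num))
  obtain ⟨n, hn, hle⟩ := exists_exp_sum_log_le hB hc hρ.1 hρ1
  have h1 := exp_le_measure_closedBall (fun k => by linarith [hc k]) hr0 hr2 μ hμ hx n hle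
  have h2 := (Real.le_log_iff_exp_le ((Real.exp_pos _).trans_le h1)).2 h1
  have h3 := Finset.sum_le_card_nsmul (Finset.range n) (fun k => -Real.log (r (k + 1))) K
    fun k _ => hK k
  rw [Finset.card_range, nsmul_eq_mul] at h3
  have h4 : (n : ℝ) * K ≤ ((1 / Real.log B + 1) * -Real.log ρ) * K := by
    refine mul_le_mul_of_nonneg_right (hn.le.trans ?_) hK0
    rw [add_mul, one_mul, div_mul_eq_mul_div, one_mul]
    linarith
  rw [div_le_iff_of_neg (by linarith)]
  linarith

/-- If the averages of `-log r` and `log c` along `n i` converge, then `log μ(B(x,ρ)) / log ρ`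
is below any number larger than the quotient of the limits for arbitrarily small `ρ`. -/
lemma frequently_log_measure_div_log_lt {a b s : ℝ} {c r : ℕ → ℝ}
    (hc : ∀ k, 0 < c (k + 1)) (hr0 : ∀ k, 0 < r (k + 1)) (hr2 : ∀ k, r (k + 1) ≤ 1 / 2)
    (μ : Measure ℝ) [IsProbabilityMeasure μ]
    (hμ : ∀ w : List Bool, μ (moranI c w) = ENNReal.ofReal (cylMass r w 1 1))
    {x : ℝ} (hx : x ∈ moranSet c) {n : ℕ → ℕ} (hn : Tendsto (fun i => (n i : ℝ)) atTop atTop)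
    (hb : 0 < b)
    (hS : Tendsto (fun i => (∑ k ∈ Finset.range (n i), -Real.log (r (k + 1))) / n i)
      atTop (𝓝 a))
    (hL : Tendsto (fun i => (∑ k ∈ Finset.range (n i), Real.log (c (k + 1))) / n i)
      atTop (𝓝 b)) (hs : a / b < s) :
    ∃ᶠ ρ in 𝓝[>] (0 : ℝ), Real.log (μ (closedBall x ρ)).toReal / Real.log ρ < s := by
  obtain ⟨hinf, hzero⟩ := tendsto_exp_neg_add_const 0 hb hn hL
  refine hzero.frequently (Eventually.frequently ?_)
  filter_upwards [hinf.eventually_gt_atTop 0,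
    (tendsto_div_add_const 0 hb.ne' hn hS hL).eventually_lt_const hs] with i hi his
  rw [add_zero] at *
  have h1 := exp_le_measure_closedBall hc hr0 hr2 μ hμ hx (n i) le_rfl
  have h2 := (Real.le_log_iff_exp_le ((Real.exp_pos _).trans_le h1)).2 h1
  refine lt_of_le_of_lt ?_ his
  rw [Real.log_exp, div_neg, ← neg_div]
  exact div_le_div_of_nonneg_right (by linarith) hi.le

/-- If the averages of `-log (1 - r)` and `log c` along `n i` converge, then
`log μ(B(x,ρ)) / log ρ` is above any number smaller than the quotient of the limits for
arbitrarily small `ρ`. -/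
lemma frequently_lt_log_measure_div_log {B a b t : ℝ} {c r : ℕ → ℝ} (hB2 : 2 < B)
    (hc : ∀ k, B ≤ c (k + 1)) (hr0 : ∀ k, 0 < r (k + 1)) (hr2 : ∀ k, r (k + 1) ≤ 1 / 2)
    (μ : Measure ℝ) [IsProbabilityMeasure μ]
    (hμ : ∀ w : List Bool, μ (moranI c w) = ENNReal.ofReal (cylMass r w 1 1))
    {x : ℝ} (hx : x ∈ moranSet c) {n : ℕ → ℕ} (hn : Tendsto (fun i => (n i : ℝ)) atTop atTop)
    (hb : 0 < b)
    (hT : Tendsto (fun i => (∑ k ∈ Finset.range (n i), -Real.log (1 - r (k + 1))) / n i)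
      atTop (𝓝 a))
    (hL : Tendsto (fun i => (∑ k ∈ Finset.range (n i), Real.log (c (k + 1))) / n i)
      atTop (𝓝 b)) (ht : t < a / b) :
    ∃ᶠ ρ in 𝓝[>] (0 : ℝ), t < Real.log (μ (closedBall x ρ)).toReal / Real.log ρ := by
  have hδ : 0 < (B - 2) / 2 := by linarith
  obtain ⟨hinf, hzero⟩ := tendsto_exp_neg_add_const (-Real.log ((B - 2) / 2)) hb hn hL
  refine hzero.frequently (Eventually.frequently ?_)
  filter_upwards [hinf.eventually_gt_atTop 0,
    (tendsto_div_add_const (-Real.log ((B - 2) / 2)) hb.ne' hn hT hL).eventually_const_lt ht]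
    with i hi hit
  set D := -Real.log ((B - 2) / 2) with hD
  obtain ⟨m, -, hm⟩ := exists_exp_sum_log_le (by linarith) hc
    (Real.exp_pos (-(∑ k ∈ Finset.range (n i), Real.log (c (k + 1)) + D)))
    (Real.exp_le_one_iff.2 (by linarith))
  have hpos := (Real.exp_pos _).trans_le
    (exp_le_measure_closedBall (fun k => by linarith [hc k]) hr0 hr2 μ hμ hx m hm)
  have h1 := measure_closedBall_le_exp hB2 hc hr0 hr2 μ hμ hx (n i)
    (ρ := Real.exp (-(∑ k ∈ Finset.range (n i), Real.log (c (k + 1)) + D))) (by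
      rw [neg_add, Real.exp_add, hD, neg_neg, Real.exp_log hδ, mul_comm]
      exact mul_lt_mul_of_pos_right (by linarith) (Real.exp_pos _))
  have h2 := (Real.log_le_iff_le_exp hpos).2 h1
  refine lt_of_lt_of_le hit ?_
  rw [Real.log_exp, div_neg, ← neg_div]
  exact div_le_div_of_nonneg_right (by linarith) hi.le

lemma exists_block_of_strictMono {N : ℕ → ℕ} (hN0 : N 0 = 0) (hN : StrictMono N) (k : ℕ) :
    ∃ i, N i < k + 1 ∧ k + 1 ≤ N (i + 1) := by
  have hex : ∃ j, k + 1 ≤ N j := ⟨k + 1, hN.id_le _⟩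
  have h0 : Nat.find hex ≠ 0 := fun h => by
    have := Nat.find_spec hex
    rw [h, hN0] at this
    omega
  obtain ⟨i, hi⟩ := Nat.exists_eq_succ_of_ne_zero h0
  refine ⟨i, not_le.1 (Nat.find_min hex (by omega)), ?_⟩
  have := Nat.find_spec hex
  rwa [hi] at this

/-- for every point x in X = supp(μ) one has d̲(μ,x) < d̄(μ,x); in particular
the local dimension lim_{r→0+} log μ(B(x,r))/log r exists at no point of the support. -/
theorem stmt_2 (A B p q : ℝ) (N : ℕ → ℕ)
    (hBA : B < A) (hB2 : 2 < B)
    (hp0 : 0 < p) (hp2 : p ≤ 1 / 2) (hq0 : 0 < q) (hq2 : q ≤ 1 / 2)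
    (hN0 : N 0 = 0) (hNmono : StrictMono N)
    (hNlim : Tendsto (fun i : ℕ => (N (i + 1) : ℝ) / (N i : ℝ)) atTop atTop)
    (hpq : -Real.log p / Real.log A < -Real.log (1 - q) / Real.log B)
    (c r : ℕ → ℝ)
    (hcA : ∀ i n : ℕ, N (2 * i) < n → n ≤ N (2 * i + 1) → c n = A)
    (hcB : ∀ i n : ℕ, N (2 * i + 1) < n → n ≤ N (2 * i + 2) → c n = B)
    (hrp : ∀ i n : ℕ, N (2 * i) < n → n ≤ N (2 * i + 1) → r n = p)
    (hrq : ∀ i n : ℕ, N (2 * i + 1) < n → n ≤ N (2 * i + 2) → r n = q)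
    (μ : Measure ℝ) [IsProbabilityMeasure μ]
    (hμ : ∀ w : List Bool, μ (moranI c w) = ENNReal.ofReal (cylMass r w 1 1))
    (x : ℝ) (hx : x ∈ moranSet c) :
    lowerLocalDim μ x < upperLocalDim μ x ∧
      ¬ ∃ L : ℝ, Tendsto
        (fun rr : ℝ => Real.log (μ (closedBall x rr)).toReal / Real.log rr)
        (𝓝[>] 0) (𝓝 L) := by
  have hval : ∀ k, (c (k + 1) = A ∧ r (k + 1) = p) ∨ (c (k + 1) = B ∧ r (k + 1) = q) := by
    intro k
    obtain ⟨i, h1, h2⟩ := exists_block_of_strictMono hN0 hNmono k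
    obtain ⟨j, rfl | rfl⟩ := i.even_or_odd'
    · exact Or.inl ⟨hcA j _ h1 h2, hrp j _ h1 h2⟩
    · exact Or.inr ⟨hcB j _ h1 h2, hrq j _ h1 h2⟩
  have hc : ∀ k, B ≤ c (k + 1) := fun k => by
    rcases hval k with h | h <;> rw [h.1]
    exact hBA.le
  have hc0 : ∀ k, 0 < c (k + 1) := fun k => by linarith [hc k]
  have hr0 : ∀ k, 0 < r (k + 1) := fun k => by
    rcases hval k with h | h <;> rw [h.2] <;> assumption
  have hr2 : ∀ k, r (k + 1) ≤ 1 / 2 := fun k => by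
    rcases hval k with h | h <;> rw [h.2] <;> assumption
  have hbdd : ∀ g : ℝ → ℝ, ∃ K, (∀ k, |g (c (k + 1))| ≤ K) ∧ ∀ k, |g (r (k + 1))| ≤ K := by
    intro g
    refine ⟨max (max |g A| |g B|) (max |g p| |g q|), fun k => ?_, fun k => ?_⟩ <;>
      rcases hval k with h | h <;> simp [h.1, h.2]
  have hNtop : Tendsto (fun i => (N i : ℝ)) atTop atTop :=
    tendsto_natCast_atTop_atTop.comp hNmono.tendsto_atTop
  have hratio : Tendsto (fun i => (N i : ℝ) / N (i + 1)) atTop (𝓝 0) :=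
    (tendsto_inv_atTop_zero.comp hNlim).congr fun i => inv_div _ _
  have hodd : Tendsto (fun i => 2 * i + 1) atTop atTop :=
    StrictMono.tendsto_atTop fun a b h => by omega
  have heven : Tendsto (fun i => 2 * i) atTop atTop :=
    StrictMono.tendsto_atTop fun a b h => by omega
  have hlogA : 0 < Real.log A := Real.log_pos (by linarith)
  have hlogB : 0 < Real.log B := Real.log_pos (by linarith)
  obtain ⟨K, hKc, hKr⟩ := hbdd Real.log
  obtain ⟨K', -, hKr'⟩ := hbdd fun y => Real.log (1 - y)
  obtain ⟨s, hs, hsb⟩ := exists_between hpq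
  obtain ⟨t, hst, ht⟩ := exists_between hsb
  set f : ℝ → ℝ := fun rr => Real.log (μ (closedBall x rr)).toReal / Real.log rr with hf
  have hlow : ∃ᶠ ρ in 𝓝[>] (0 : ℝ), f ρ < s := by
    refine frequently_log_measure_div_log_lt hc0 hr0 hr2 μ hμ hx (hNtop.comp hodd) hlogA ?_ ?_ hs
    · exact tendsto_average_of_eq_on_block (u := fun k => -Real.log (r k))
        (fun k => (abs_neg _).trans_le (hKr k)) (fun i => hNmono (Nat.lt_succ_self _))
        (hratio.comp heven) fun i k h1 h2 => by rw [hrp i k h1 h2]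
    · exact tendsto_average_of_eq_on_block (u := fun k => Real.log (c k))
        hKc (fun i => hNmono (Nat.lt_succ_self _))
        (hratio.comp heven) fun i k h1 h2 => by rw [hcA i k h1 h2]
  have hup : ∃ᶠ ρ in 𝓝[>] (0 : ℝ), t < f ρ := by
    refine frequently_lt_log_measure_div_log hB2 hc hr0 hr2 μ hμ hx
      (hNtop.comp ((tendsto_add_atTop_nat 1).comp hodd)) hlogB ?_ ?_ ht
    · exact tendsto_average_of_eq_on_block (u := fun k => -Real.log (1 - r k))
        (fun k => (abs_neg _).trans_le (hKr' k)) (fun i => hNmono (Nat.lt_succ_self _))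
        (hratio.comp hodd) fun i k h1 h2 => by rw [hrq i k h1 h2]
    · exact tendsto_average_of_eq_on_block (u := fun k => Real.log (c k))
        hKc (fun i => hNmono (Nat.lt_succ_self _))
        (hratio.comp hodd) fun i k h1 h2 => by rw [hcB i k h1 h2]
  have hbelow : IsBoundedUnder (· ≥ ·) (𝓝[>] (0 : ℝ)) f :=
    isBoundedUnder_of_eventually_ge (eventually_log_measure_div_log_nonneg μ x)
  have habove : IsBoundedUnder (· ≤ ·) (𝓝[>] (0 : ℝ)) f :=
    isBoundedUnder_of_eventually_le (eventually_log_measure_div_log_le (by linarith) hc hr0 hr2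
      (fun k => (neg_le_abs _).trans (hKr k)) μ hμ hx)
  have hlt : liminf f (𝓝[>] 0) < limsup f (𝓝[>] 0) :=
    (liminf_le_of_frequently_le (hlow.mono fun _ h => h.le) hbelow).trans_lt
      (hst.trans_le (le_limsup_of_frequently_le (hup.mono fun _ h => h.le) habove))
  exact ⟨hlt, fun ⟨L, hL⟩ => hlt.ne (hL.liminf_eq.trans hL.limsup_eq.symm)⟩
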